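/- Let U ⊆ P(d,m) be a color-squarefree monomial order ideal. Then the Hilbert series of the Stanley-Reisner ring K[Δ_bal(U)] = P(d, m+(1,…,1))/I_{Δ_bal(U)} with respect to the standard ℤ-grading is (a_0 + a_1 t + ⋯ + a_d t^d)/(1−t)^d, where a_i = #{u ∈ U : deg(u) = i}. In particular, K[Δ_bal(U)] and P(d, m+(1,…,1))/(I(U)·P(d, m+(1,…,1))) have the same Hilbert series. -/

import Mathlib

open Finset

noncomputable section

namespace BalSq

variable {d : ℕ} {m : Fin d → ℕ}

/-- The set of variables `x_{i,j}` of `P(d,m)`: the variable `⟨i,j⟩` has color `i`. -/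
abbrev Var (d : ℕ) (m : Fin d → ℕ) : Type := Σ i : Fin d, Fin (m i)

/-- Monomials of `P(d,m)`, encoded as exponent vectors. -/
abbrev Mon (d : ℕ) (m : Fin d → ℕ) : Type := Var d m →₀ ℕ

/-- The vertex set `V = V_1 ∪ ⋯ ∪ V_d`, where `V_i` has `m i + 1` elements;
these are also the variables of `P(d, m + (1,…,1))`. -/
abbrev Vtx (d : ℕ) (m : Fin d → ℕ) : Type := Σ i : Fin d, Fin (m i + 1)

/-- The monomial `x_{i,j}`. -/
def xvar (i : Fin d) (j : Fin (m i)) : Mon d m := Finsupp.single ⟨i, j⟩ 1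

/-- Total degree of a monomial. -/
def deg (u : Mon d m) : ℕ := u.sum fun _ n => n

/-- A monomial is color-squarefree if it is divisible by at most one variable of each color. -/
def ColorSquarefree (u : Mon d m) : Prop :=
  ∀ i : Fin d, (∑ j : Fin (m i), u ⟨i, j⟩) ≤ 1

/-- A color-squarefree monomial order ideal: a finite set of color-squarefree monomials,
closed under divisibility, containing `1` and all the variables. -/
def IsOrderIdeal (U : Finset (Mon d m)) : Prop :=
  (∀ u ∈ U, ColorSquarefree u) ∧
  (∀ u ∈ U, ∀ v : Mon d m, v ≤ u → v ∈ U) ∧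
  ((0 : Mon d m) ∈ U) ∧
  (∀ (i : Fin d) (j : Fin (m i)), xvar i j ∈ U)

/-- The strict order `≺` on variables: `x_{i,j} ≺ x_{k,ℓ}` iff `i < k`, or `i = k` and `j < ℓ`. -/
def vlt (a b : Var d m) : Prop :=
  a.1 < b.1 ∨ (a.1 = b.1 ∧ (a.2 : ℕ) < (b.2 : ℕ))

/-- The vertex of color `i` of the facet `F_d(u)`: the (unique) `j` with `x_{i,j} ∣ u` if it
exists, and the extra vertex `(m i + 1)^{(i)}` otherwise. -/
def vtxOf (u : Mon d m) (i : Fin d) : Fin (m i + 1) :=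
  if h : ∃ j : Fin (m i), u ⟨i, j⟩ ≠ 0 then (Classical.choose h).castSucc else Fin.last (m i)

/-- The facet `F_d(u)` associated to a color-squarefree monomial `u`. -/
def Fd (u : Mon d m) : Finset (Vtx d m) :=
  Finset.univ.image fun i : Fin d => (⟨i, vtxOf u i⟩ : Vtx d m)

/-- The balanced (squeezed) complex `Δ_bal(U)` of a finite set `U` of color-squarefree
monomials: the simplicial complex whose facets are the sets `F_d(u)`, `u ∈ U`. -/
def Dbal (U : Finset (Mon d m)) : Set (Finset (Vtx d m)) :=
  { F | ∃ u ∈ U, F ⊆ Fd u }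

variable (K : Type*) [Field K]

/-- The polynomial ring `P(d,m)`. -/
abbrev PR (d : ℕ) (m : Fin d → ℕ) (K : Type*) [Field K] : Type _ :=
  MvPolynomial (Var d m) K

/-- The monomial of `P(d,m)` with exponent vector `u`. -/
def mon (u : Mon d m) : PR d m K := MvPolynomial.monomial u 1

/-- The ideal `I(U)` generated by all monomials of `P(d,m)` not lying in `U`. -/
def IU (U : Finset (Mon d m)) : Ideal (PR d m K) :=
  Ideal.span { p : PR d m K | ∃ u : Mon d m, u ∉ U ∧ p = mon K u }

/-- The ideal `𝔪_1^2 + ⋯ + 𝔪_d^2` of `P(d,m)`. -/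
def sqIdeal : Ideal (PR d m K) :=
  Ideal.span { p : PR d m K | ∃ (i : Fin d) (j k : Fin (m i)),
    p = mon K (xvar i j + xvar i k) }

/-- A monomial ideal is strongly color-stable if `x_{k,ℓ}·u ∈ I` and `j < ℓ` imply
`x_{k,j}·u ∈ I`. -/
def StronglyColorStable (I : Ideal (PR d m K)) : Prop :=
  ∀ (u : Mon d m) (k : Fin d) (l j : Fin (m k)),
    mon K (xvar k l + u) ∈ I → j < l → mon K (xvar k j + u) ∈ I

/-- Strongly color-stable across colors. -/
def StronglyColorStableAcross (I : Ideal (PR d m K)) : Prop :=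
  StronglyColorStable K I ∧
  ∀ (u : Mon d m) (k : Fin d) (l : Fin (m k)) (i : Fin d) (j : Fin (m i)),
    ColorSquarefree (xvar k l + u) → mon K (xvar k l + u) ∈ I →
    vlt ⟨i, j⟩ ⟨k, l⟩ → ColorSquarefree (xvar i j + u) → mon K (xvar i j + u) ∈ I

/-- The minimal monomial generators of a monomial ideal. -/
def MinGens (I : Ideal (PR d m K)) : Set (Mon d m) :=
  { w | mon K w ∈ I ∧ ∀ v : Mon d m, v ≤ w → v ≠ w → mon K v ∉ I }

/-- The embedding of the variables of `P(d,m)` into those of `P(d, m + (1,…,1))`,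
identifying the vertex `j^{(i)}` with the variable `x_{i,j}`. -/
def emb : Var d m → Vtx d m := fun v => ⟨v.1, v.2.castSucc⟩

/-- The polynomial ring `P(d, m + (1,…,1))`. -/
abbrev Pp (d : ℕ) (m : Fin d → ℕ) (K : Type*) [Field K] : Type _ :=
  MvPolynomial (Vtx d m) K

/-- The Stanley-Reisner ideal of a simplicial complex on the vertex set `V`,
generated by the squarefree monomials corresponding to non-faces. -/
def SRIdeal (Δ : Set (Finset (Vtx d m))) : Ideal (Pp d m K) :=
  Ideal.span { p : Pp d m K | ∃ F : Finset (Vtx d m), F ∉ Δ ∧ p = ∏ v ∈ F, MvPolynomial.X v }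

/-- The Hilbert function of `P(d,m+(1,…,1))/J` with respect to the standard grading:
the `K`-dimension of the image of the degree-`n` homogeneous part in the quotient. -/
def hilb (J : Ideal (Pp d m K)) (n : ℕ) : ℕ :=
  Module.finrank K
    (Submodule.map
      (Submodule.mkQ (Submodule.restrictScalars K (J : Submodule (Pp d m K) (Pp d m K))))
      (MvPolynomial.homogeneousSubmodule (Vtx d m) K n))

/-- Standard monomials of degree `n` for the exponent set `S`. -/
def stdMon (S : Set (Vtx d m →₀ ℕ)) (n : ℕ) : Set (Vtx d m →₀ ℕ) :=
  {w | w.degree = n ∧ ∀ s ∈ S, ¬ s ≤ w}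

theorem hilb_span (S : Set (Vtx d m →₀ ℕ)) (n : ℕ) :
    hilb K (Ideal.span ((fun s => MvPolynomial.monomial s (1 : K)) '' S)) n
      = (stdMon S n).ncard := by
  classical
  set J : Ideal (Pp d m K) := Ideal.span ((fun s => MvPolynomial.monomial s (1 : K)) '' S) with hJ
  set q := Submodule.mkQ (Submodule.restrictScalars K (J : Submodule (Pp d m K) (Pp d m K))) with hq
  set C : Submodule K (Pp d m K) := MvPolynomial.restrictSupport K (stdMon S n) with hC
  have hmem : ∀ p : Pp d m K, q p = 0 ↔ p ∈ J := by
    intro p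
    rw [hq, Submodule.mkQ_apply, Submodule.Quotient.mk_eq_zero, Submodule.restrictScalars_mem]
  have hdw : ∀ w : Vtx d m →₀ ℕ, Finsupp.weight 1 w = w.degree := fun w =>
    (DFunLike.congr_fun (Finsupp.degree_eq_weight_one (R := ℕ)) w).symm
  have hH : MvPolynomial.homogeneousSubmodule (Vtx d m) K n
      = MvPolynomial.restrictSupport K {w : Vtx d m →₀ ℕ | w.degree = n} := by
    ext p
    rw [MvPolynomial.mem_homogeneousSubmodule, MvPolynomial.mem_restrictSupport_iff,
      MvPolynomial.IsHomogeneous, MvPolynomial.IsWeightedHomogeneous]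
    constructor
    · intro h w hw
      have := h (MvPolynomial.mem_support_iff.1 hw)
      exact (hdw w).symm.trans this
    · intro h w hw
      have := h (MvPolynomial.mem_support_iff.2 hw)
      exact (hdw w).trans this
  have hmap : Submodule.map q (MvPolynomial.homogeneousSubmodule (Vtx d m) K n)
      = Submodule.map q C := by
    apply le_antisymm
    · rw [hH, MvPolynomial.restrictSupport_eq_span, Submodule.map_span_le]
      rintro _ ⟨w, hw, rfl⟩
      by_cases h : ∀ s ∈ S, ¬ s ≤ w
      · refine Submodule.mem_map_of_mem ?_
        rw [hC, MvPolynomial.monomial_mem_restrictSupport]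
        exact Or.inl ⟨hw, h⟩
      · push Not at h
        have : q (MvPolynomial.monomial w 1) = 0 := by
          rw [hmem, hJ, MvPolynomial.mem_ideal_span_monomial_image]
          intro x hx
          have := MvPolynomial.support_monomial_subset hx
          rw [Finset.mem_singleton] at this
          rw [this]; exact h
        show q (MvPolynomial.monomial w 1) ∈ _
        rw [this]; exact Submodule.zero_mem _
    · apply Submodule.map_mono
      rw [hH]
      exact MvPolynomial.restrictSupport_mono _ fun w hw => hw.1
  have hinj : Function.Injective (q.domRestrict C) := by
    rw [← LinearMap.ker_eq_bot, LinearMap.ker_eq_bot']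
    rintro ⟨p, hp⟩ h0
    rw [LinearMap.domRestrict_apply, hmem, hJ, MvPolynomial.mem_ideal_span_monomial_image] at h0
    rw [hC, MvPolynomial.mem_restrictSupport_iff] at hp
    ext1
    show p = 0
    rw [← MvPolynomial.support_eq_empty]
    apply Finset.eq_empty_of_forall_notMem
    intro x hx
    obtain ⟨s, hs, hsx⟩ := h0 x hx
    exact (hp hx).2 s hs hsx
  have hr : LinearMap.range (q.domRestrict C) = Submodule.map q C := LinearMap.range_domRestrict _ _
  rw [hilb, hmap, ← hr, LinearMap.finrank_range_of_inj hinj,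
    Module.finrank_eq_nat_card_basis (MvPolynomial.basisRestrictSupport K (stdMon S n))]
  rfl

/-- Exponents of squarefree monomials of nonfaces. -/
def SRexp (Δ : Set (Finset (Vtx d m))) : Set (Vtx d m →₀ ℕ) :=
  {s | ∃ F : Finset (Vtx d m), F ∉ Δ ∧ s = ∑ v ∈ F, Finsupp.single v 1}

theorem SRIdeal_eq (Δ : Set (Finset (Vtx d m))) :
    SRIdeal K Δ = Ideal.span ((fun s => MvPolynomial.monomial s (1 : K)) '' SRexp Δ) := by
  rw [SRIdeal]
  congr 1
  have key : ∀ F : Finset (Vtx d m), MvPolynomial.monomial (∑ v ∈ F, Finsupp.single v 1) (1 : K)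
      = ∏ v ∈ F, MvPolynomial.X v := by
    intro F
    rw [MvPolynomial.monomial_sum_one]; rfl
  ext p
  constructor
  · rintro ⟨F, hF, rfl⟩
    exact ⟨_, ⟨F, hF, rfl⟩, key F⟩
  · rintro ⟨_, ⟨F, hF, rfl⟩, rfl⟩
    exact ⟨F, hF, key F⟩

theorem SRexp_std (U : Finset (Mon d m)) (w : Vtx d m →₀ ℕ) :
    (∀ s ∈ SRexp (Dbal U), ¬ s ≤ w) ↔ w.support ∈ Dbal U := by
  classical
  have key : ∀ (F : Finset (Vtx d m)), (∑ v ∈ F, Finsupp.single v 1) ≤ w ↔ F ⊆ w.support := by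
    intro F
    have hv : ∀ x, (∑ v ∈ F, Finsupp.single v 1 : Vtx d m →₀ ℕ) x = if x ∈ F then 1 else 0 := by
      intro x
      rw [Finsupp.finsetSum_apply]
      simp [Finsupp.single_apply]
    constructor
    · intro h x hx
      have := h x
      rw [hv, if_pos hx] at this
      rw [Finsupp.mem_support_iff]; omega
    · intro h x
      rw [hv]
      split_ifs with hx
      · have := h hx
        rw [Finsupp.mem_support_iff] at this; omega
      · exact Nat.zero_le _
  constructor
  · intro h
    by_contra hn
    exact h _ ⟨_, hn, rfl⟩ ((key _).2 (Finset.Subset.refl _))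
  · rintro ⟨u, hu, hw⟩ _ ⟨F, hF, rfl⟩ hle
    exact hF ⟨u, hu, ((key F).1 hle).trans hw⟩

theorem emb_inj : Function.Injective (emb : Var d m → Vtx d m) := by
  rintro ⟨i, j⟩ ⟨i', j'⟩ h
  simp only [emb, Sigma.mk.injEq] at h
  obtain ⟨rfl, h⟩ := h
  have := Fin.castSucc_injective _ (eq_of_heq h)
  rw [this]

/-- Exponents of the extended ideal. -/
def IUexp (U : Finset (Mon d m)) : Set (Vtx d m →₀ ℕ) :=
  {s | ∃ u : Mon d m, u ∉ U ∧ s = Finsupp.mapDomain emb u}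

theorem IU_eq (U : Finset (Mon d m)) :
    Ideal.map (MvPolynomial.rename (emb : Var d m → Vtx d m)) (IU K U)
      = Ideal.span ((fun s => MvPolynomial.monomial s (1 : K)) '' IUexp U) := by
  rw [IU, Ideal.map_span]
  congr 1
  ext p
  constructor
  · rintro ⟨_, ⟨u, hu, rfl⟩, rfl⟩
    exact ⟨_, ⟨u, hu, rfl⟩, by simp [mon, MvPolynomial.rename_monomial]⟩
  · rintro ⟨_, ⟨u, hu, rfl⟩, rfl⟩
    exact ⟨_, ⟨u, hu, rfl⟩, by simp [mon, MvPolynomial.rename_monomial]⟩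

/-- Restriction of an exponent vector to the original variables. -/
def res (w : Vtx d m →₀ ℕ) : Mon d m := Finsupp.equivFunOnFinite.symm fun v => w (emb v)

theorem res_apply (w : Vtx d m →₀ ℕ) (v : Var d m) : res w v = w (emb v) := rfl

theorem IUexp_std (U : Finset (Mon d m)) (hU : IsOrderIdeal U) (w : Vtx d m →₀ ℕ) :
    (∀ s ∈ IUexp U, ¬ s ≤ w) ↔ res w ∈ U := by
  have key : ∀ u : Mon d m, Finsupp.mapDomain emb u ≤ w ↔ u ≤ res w := by
    intro u
    constructor
    · intro h v
      have := h (emb v)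
      rwa [Finsupp.mapDomain_apply emb_inj] at this
    · intro h x
      by_cases hx : x ∈ Set.range (emb : Var d m → Vtx d m)
      · obtain ⟨v, rfl⟩ := hx
        rw [Finsupp.mapDomain_apply emb_inj]
        exact h v
      · rw [Finsupp.mapDomain_of_notMem_range _ _ hx]
        exact Nat.zero_le _
  constructor
  · intro h
    by_contra hn
    exact h _ ⟨_, hn, rfl⟩ ((key _).2 le_rfl)
  · rintro h _ ⟨u, hu, rfl⟩ hle
    exact hu (hU.2.1 _ h u ((key u).1 hle))

/-- Common index set for the standard monomials. -/
def idx (U : Finset (Mon d m)) (n : ℕ) : Finset (Σ _ : Mon d m, (Fin d →₀ ℕ)) :=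
  U.sigma fun u => if deg u ≤ n then finsuppAntidiag Finset.univ (n - deg u) else ∅

theorem mem_idx (U : Finset (Mon d m)) (n : ℕ) (u : Mon d m) (e : Fin d →₀ ℕ) :
    (⟨u, e⟩ : Σ _ : Mon d m, (Fin d →₀ ℕ)) ∈ idx U n ↔ u ∈ U ∧ deg u + ∑ i, e i = n := by
  rw [idx, Finset.mem_sigma]
  refine and_congr_right fun _ => ?_
  dsimp only
  split_ifs with h
  · simp only [mem_finsuppAntidiag, Finset.subset_univ, and_true]
    change ∑ i, e i = _ ↔ _
    omega
  · simp only [Finset.notMem_empty, false_iff]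
    omega

/-- The monomial with `e i` added on the vertex `c i` to the extension of `u`. -/
def phi (c : ∀ i : Fin d, Fin (m i + 1)) (u : Mon d m) (e : Fin d →₀ ℕ) : Vtx d m →₀ ℕ :=
  Finsupp.equivFunOnFinite.symm fun v =>
    (if h : (v.2 : ℕ) < m v.1 then u ⟨v.1, ⟨v.2, h⟩⟩ else 0) + if v.2 = c v.1 then e v.1 else 0

theorem phi_cast (c : ∀ i : Fin d, Fin (m i + 1)) (u : Mon d m) (e : Fin d →₀ ℕ)
    (i : Fin d) (j : Fin (m i)) :
    phi c u e ⟨i, j.castSucc⟩ = u ⟨i, j⟩ + if j.castSucc = c i then e i else 0 := by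
  simp [phi]

theorem phi_last (c : ∀ i : Fin d, Fin (m i + 1)) (u : Mon d m) (e : Fin d →₀ ℕ)
    (i : Fin d) :
    phi c u e ⟨i, Fin.last _⟩ = if Fin.last _ = c i then e i else 0 := by
  simp [phi]

theorem phi_degree (c : ∀ i : Fin d, Fin (m i + 1)) (u : Mon d m) (e : Fin d →₀ ℕ) :
    (phi c u e).degree = deg u + ∑ i, e i := by
  have h1 : deg u = ∑ v, u v := by
    rw [deg, Finsupp.sum_fintype]; simp
  rw [h1, Finsupp.degree_eq_sum, Fintype.sum_sigma, Fintype.sum_sigma, ← Finset.sum_add_distrib]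
  refine Finset.sum_congr rfl fun i _ => ?_
  have h2 : ∑ j : Fin (m i + 1), (if j = c i then e i else 0) = e i := by simp
  rw [Fin.sum_univ_castSucc] at h2 ⊢
  simp only [phi_cast, phi_last, Finset.sum_add_distrib]
  omega

theorem csf_le {u : Mon d m} (hu : ColorSquarefree u) (i : Fin d) (j : Fin (m i)) :
    u ⟨i, j⟩ ≤ 1 :=
  (Finset.single_le_sum (f := fun j => u ⟨i, j⟩) (fun _ _ => Nat.zero_le _)
    (Finset.mem_univ j)).trans (hu i)

theorem csf_unique {u : Mon d m} (hu : ColorSquarefree u) (i : Fin d) (j k : Fin (m i))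
    (hj : u ⟨i, j⟩ ≠ 0) (hk : u ⟨i, k⟩ ≠ 0) : j = k := by
  classical
  by_contra hne
  have h1 : ∑ l ∈ ({j, k} : Finset (Fin (m i))), u ⟨i, l⟩ ≤ ∑ l, u ⟨i, l⟩ :=
    Finset.sum_le_sum_of_subset (Finset.subset_univ _)
  rw [Finset.sum_pair hne] at h1
  have := hu i
  omega

theorem vtxOf_cast {u : Mon d m} (hu : ColorSquarefree u) (i : Fin d) (j : Fin (m i)) :
    j.castSucc = vtxOf u i ↔ u ⟨i, j⟩ ≠ 0 := by
  rw [vtxOf]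
  split_ifs with h
  · rw [Fin.castSucc_inj]
    constructor
    · intro hj
      rw [hj]; exact Classical.choose_spec h
    · intro hj
      exact csf_unique hu i _ _ hj (Classical.choose_spec h)
  · push Not at h
    simp [h j, Fin.castSucc_ne_last]

theorem vtxOf_last (u : Mon d m) (i : Fin d) :
    Fin.last _ = vtxOf u i ↔ ∀ j, u ⟨i, j⟩ = 0 := by
  rw [vtxOf]
  split_ifs with h
  · refine iff_of_false (fun h' => Fin.castSucc_ne_last _ h'.symm) ?_
    push Not; exact h
  · push Not at h
    simpa using h

theorem vtx_ext {w w' : Vtx d m →₀ ℕ} (h1 : ∀ i (j : Fin (m i)), w ⟨i, j.castSucc⟩ = w' ⟨i, j.castSucc⟩)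
    (h2 : ∀ i, w ⟨i, Fin.last _⟩ = w' ⟨i, Fin.last _⟩) : w = w' := by
  ext ⟨i, k⟩
  induction k using Fin.lastCases with
  | last => exact h2 i
  | cast j => exact h1 i j

theorem card_IU (U : Finset (Mon d m)) (hU : IsOrderIdeal U) (n : ℕ) :
    (stdMon (IUexp U) n).ncard = (idx U n).card := by
  rw [← Set.ncard_coe_finset]
  symm
  have hres : ∀ u e, res (phi (fun i => Fin.last (m i)) u e) = u := by
    intro u e
    ext ⟨i, j⟩
    rw [res_apply, emb, phi_cast, if_neg (Fin.castSucc_ne_last _), add_zero]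
  refine Set.ncard_congr (fun p _ => phi (fun i => Fin.last (m i)) p.1 p.2) ?_ ?_ ?_
  · rintro ⟨u, e⟩ hp
    rw [Finset.mem_coe, mem_idx] at hp
    refine ⟨(phi_degree _ _ _).trans hp.2, ?_⟩
    rw [IUexp_std U hU, hres]
    exact hp.1
  · rintro ⟨u, e⟩ ⟨u', e'⟩ _ _ h
    dsimp only at h
    have hu : u = u' := by rw [← hres u e, h, hres]
    subst hu
    have he : e = e' := by
      ext i
      have := DFunLike.congr_fun h ⟨i, Fin.last _⟩
      simpa [phi_last] using this
    rw [he]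
  · rintro w ⟨hw, hs⟩
    rw [IUexp_std U hU] at hs
    have hE : phi (fun i => Fin.last (m i)) (res w)
        (Finsupp.equivFunOnFinite.symm fun i => w ⟨i, Fin.last _⟩) = w := by
      apply vtx_ext
      · intro i j
        rw [phi_cast, if_neg (Fin.castSucc_ne_last _), add_zero]; rfl
      · intro i
        rw [phi_last, if_pos rfl]; rfl
    refine ⟨⟨res w, _⟩, ?_, hE⟩
    rw [Finset.mem_coe, mem_idx, ← phi_degree (fun i => Fin.last (m i)), hE]
    exact ⟨hs, hw⟩

theorem mem_Fd (u : Mon d m) (i : Fin d) (k : Fin (m i + 1)) :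
    (⟨i, k⟩ : Vtx d m) ∈ Fd u ↔ k = vtxOf u i := by
  rw [Fd, Finset.mem_image]
  constructor
  · rintro ⟨i', _, h⟩
    simp only [Sigma.mk.injEq] at h
    obtain ⟨rfl, h⟩ := h
    exact (eq_of_heq h).symm
  · rintro rfl
    exact ⟨i, Finset.mem_univ _, rfl⟩

theorem card_SR (U : Finset (Mon d m)) (hU : IsOrderIdeal U) (n : ℕ) :
    (stdMon (SRexp (Dbal U)) n).ncard = (idx U n).card := by
  rw [← Set.ncard_coe_finset]
  symm
  have hcast : ∀ u ∈ U, ∀ (e : Fin d →₀ ℕ) (i : Fin d) (j : Fin (m i)),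
      phi (vtxOf u) u e ⟨i, j.castSucc⟩ = if u ⟨i, j⟩ ≠ 0 then 1 + e i else 0 := by
    intro u hu e i j
    have hc := hU.1 u hu
    rw [phi_cast]
    simp only [vtxOf_cast hc]
    have := csf_le hc i j
    split_ifs <;> omega
  have hlast : ∀ (u : Mon d m) (e : Fin d →₀ ℕ) (i : Fin d),
      phi (vtxOf u) u e ⟨i, Fin.last _⟩ = if (∀ j, u ⟨i, j⟩ = 0) then e i else 0 := by
    intro u e i
    rw [phi_last]
    simp only [vtxOf_last]
  refine Set.ncard_congr (fun p _ => phi (vtxOf p.1) p.1 p.2) ?_ ?_ ?_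
  · rintro ⟨u, e⟩ hp
    rw [Finset.mem_coe, mem_idx] at hp
    refine ⟨(phi_degree _ _ _).trans hp.2, ?_⟩
    rw [SRexp_std U]
    refine ⟨u, hp.1, ?_⟩
    rintro ⟨i, k⟩ hk
    rw [Finsupp.mem_support_iff] at hk
    rw [mem_Fd]
    induction k using Fin.lastCases with
    | last =>
      dsimp only at hk
      rw [hlast] at hk
      rw [vtxOf_last]
      by_contra hn
      exact hk (if_neg hn)
    | cast j =>
      dsimp only at hk
      rw [hcast u hp.1] at hk
      rw [vtxOf_cast (hU.1 u hp.1)]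
      by_contra hn
      exact hk (if_neg (not_not.2 hn))
  · rintro ⟨u, e⟩ ⟨u', e'⟩ hp hp' h
    rw [Finset.mem_coe, mem_idx] at hp hp'
    dsimp only at h
    have hu : u = u' := by
      ext ⟨i, j⟩
      have h1 := DFunLike.congr_fun h ⟨i, j.castSucc⟩
      rw [hcast u hp.1, hcast u' hp'.1] at h1
      have h2 := csf_le (hU.1 u hp.1) i j
      have h3 := csf_le (hU.1 u' hp'.1) i j
      split_ifs at h1 <;> omega
    subst hu
    have he : e = e' := by
      ext i
      by_cases hj : ∀ j, u ⟨i, j⟩ = 0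
      · have h1 := DFunLike.congr_fun h ⟨i, Fin.last _⟩
        rwa [hlast, hlast, if_pos hj, if_pos hj] at h1
      · push Not at hj
        obtain ⟨j, hj⟩ := hj
        have h1 := DFunLike.congr_fun h ⟨i, j.castSucc⟩
        rw [hcast u hp.1, hcast u hp.1, if_pos hj, if_pos hj] at h1
        omega
    rw [he]
  · rintro w ⟨hw, hs⟩
    rw [SRexp_std U] at hs
    obtain ⟨u0, hu0, hsub⟩ := hs
    have hv : ∀ i k, w ⟨i, k⟩ ≠ 0 → k = vtxOf u0 i := by
      intro i k hk
      rw [← mem_Fd]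
      exact hsub (Finsupp.mem_support_iff.2 hk)
    have hc0 := hU.1 u0 hu0
    let u : Mon d m := Finsupp.equivFunOnFinite.symm fun v => min 1 (w (emb v))
    have hua : ∀ i j, u ⟨i, j⟩ = min 1 (w ⟨i, j.castSucc⟩) := fun i j => rfl
    have hle : u ≤ u0 := by
      rintro ⟨i, j⟩
      rw [hua]
      by_cases h0 : w ⟨i, j.castSucc⟩ = 0
      · rw [h0]; simp
      · have := (vtxOf_cast hc0 i j).1 (hv i _ h0)
        omega
    have huU : u ∈ U := hU.2.1 u0 hu0 u hle
    have hc := hU.1 u huU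
    let e : Fin d →₀ ℕ := Finsupp.equivFunOnFinite.symm fun i =>
      w ⟨i, vtxOf u i⟩ - if (∀ j, u ⟨i, j⟩ = 0) then 0 else 1
    have hea : ∀ i, e i = w ⟨i, vtxOf u i⟩ - if (∀ j, u ⟨i, j⟩ = 0) then 0 else 1 := fun i => rfl
    have hE : phi (vtxOf u) u e = w := by
      apply vtx_ext
      · intro i j
        rw [hcast u huU]
        split_ifs with h
        · rw [hea, if_neg (fun h' => h (h' j)), ← (vtxOf_cast hc i j).2 h]
          rw [hua] at h
          omega
        · rw [hua] at h
          omega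
      · intro i
        rw [hlast]
        split_ifs with h
        · rw [hea, if_pos h, ← (vtxOf_last u i).2 h]
          rfl
        · by_contra hn
          have h1 := (vtxOf_last u0 i).1 (hv i _ (Ne.symm hn))
          apply h
          intro j
          have := hle ⟨i, j⟩
          rw [h1 j] at this
          omega
    refine ⟨⟨u, e⟩, ?_, hE⟩
    rw [Finset.mem_coe, mem_idx, ← phi_degree (vtxOf u), hE]
    exact ⟨huU, hw⟩

theorem idx_series (U : Finset (Mon d m)) :
    PowerSeries.mk (fun n => ((idx U n).card : ℤ))
      = (PowerSeries.mk 1) ^ d * ∑ u ∈ U, (PowerSeries.X : PowerSeries ℤ) ^ deg u := by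
  ext n
  rw [PowerSeries.coeff_mk, Finset.mul_sum, map_sum, idx, Finset.card_sigma, Nat.cast_sum]
  refine Finset.sum_congr rfl fun u _ => ?_
  rw [PowerSeries.coeff_mul_X_pow']
  split_ifs with h
  · have h1 : (PowerSeries.mk 1 : PowerSeries ℤ) ^ d = ∏ _i : Fin d, PowerSeries.mk 1 := by simp
    rw [h1, PowerSeries.coeff_prod]
    simp
  · simp

theorem deg_le {u : Mon d m} (hu : ColorSquarefree u) : deg u ≤ d := by
  have h1 : deg u = ∑ v, u v := by
    rw [deg, Finsupp.sum_fintype]; simp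
  rw [h1, Fintype.sum_sigma]
  calc _ ≤ ∑ _i : Fin d, 1 := Finset.sum_le_sum fun i _ => hu i
    _ = d := by simp


/-- from the proof of Theorem `thm:gin`.  The Hilbert series of
`K[Δ_bal(U)]` is `(a_0 + a_1 t + ⋯ + a_d t^d)/(1-t)^d`, where
`a_i = #{u ∈ U : deg u = i}`; in particular `K[Δ_bal(U)]` and
`P(d,m+(1,…,1))/(I(U)·P(d,m+(1,…,1)))` have the same Hilbert series. -/
theorem statement_10 (U : Finset (Mon d m)) (hU : IsOrderIdeal U) :
    ((1 - PowerSeries.X : PowerSeries ℤ) ^ d *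
        PowerSeries.mk (fun n => (hilb K (SRIdeal K (Dbal U)) n : ℤ))
      = ∑ i ∈ Finset.range (d + 1),
          (PowerSeries.monomial (R := ℤ) i) (((U.filter fun u => deg u = i).card : ℤ))) ∧
    (∀ n : ℕ, hilb K (SRIdeal K (Dbal U)) n
      = hilb K (Ideal.map (MvPolynomial.rename (emb : Var d m → Vtx d m)) (IU K U)) n) := by
  
  have hSR : ∀ n, hilb K (SRIdeal K (Dbal U)) n = (idx U n).card := fun n => by
    rw [SRIdeal_eq, hilb_span, card_SR U hU]
  refine ⟨?_, fun n => ?_⟩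
  · simp only [hSR]
    rw [idx_series, ← mul_assoc, ← mul_pow, mul_comm (1 - PowerSeries.X),
      PowerSeries.mk_one_mul_one_sub_eq_one, one_pow, one_mul]
    rw [← Finset.sum_fiberwise_of_maps_to (t := Finset.range (d + 1)) (g := deg)
      (fun u hu => Finset.mem_range.2 (Nat.lt_succ_of_le (deg_le (hU.1 u hu))))]
    refine Finset.sum_congr rfl fun i _ => ?_
    rw [Finset.sum_congr rfl (g := fun _ => (PowerSeries.X : PowerSeries ℤ) ^ i)
      (fun u hu => by rw [(Finset.mem_filter.1 hu).2])]
    rw [Finset.sum_const, PowerSeries.X_pow_eq, ← map_nsmul]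
    simp
  · rw [hSR, IU_eq, hilb_span, card_IU U hU]

end BalSq
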